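/- Let P = P(d) be the natural unit interval order on {1,…,n} of a Dyck path d with bounce number 3, and let 0 ≤ l ≤ min{a,b,c}. Then there exists an injective map from the disjoint union of the set of P-tableaux of shape 3^l 2^2 1^{n-3l-4} and the set of P-tableaux of shape 3^{l+1} 1^{n-3l-3} into the disjoint union of the set of P-tableaux of shape 3^l 2^1 1^{n-3l-2} and the set of P-tableaux of shape 3^{l+1} 2^1 1^{n-3l-5}, which preserves the number of inversions. -/

import Mathlib

open scoped Classical

/-- A Dyck path on an `n × n` board: a weakly increasing sequence
`d 1 ≤ d 2 ≤ ⋯ ≤ d (n-1) ≤ n` with `i ≤ d i`; we record it on indices `1, …, n`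
with the harmless boundary convention `d n = n`. -/
structure DyckPath (n : ℕ) where
  d : ℕ → ℕ
  mono : ∀ i j : ℕ, 1 ≤ i → i ≤ j → j ≤ n → d i ≤ d j
  le_n : ∀ i : ℕ, 1 ≤ i → i ≤ n → d i ≤ n
  ge_self : ∀ i : ℕ, 1 ≤ i → i ≤ n → i ≤ d i
  top : d n = n

/-- The shape `3^l 2^j 1^m`, as a list of row lengths. -/
def shape (l j m : ℕ) : List ℕ :=
  List.replicate l 3 ++ List.replicate j 2 ++ List.replicate m 1

/-- Position in the row-by-row reading word where row `i` (0-indexed) starts. -/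
def rowStart (μ : List ℕ) (i : ℕ) : ℕ := (μ.take i).sum

/-- The entry in row `i`, column `j` (both 0-indexed) of the tableau of shape `μ`
whose row-by-row reading word is `L`. -/
def entry (μ L : List ℕ) (i j : ℕ) : ℕ := L.getD (rowStart μ i + j) 0

/-- The cells (row, column), 0-indexed, of the Young diagram with row lengths `μ`. -/
def cellsOf (μ : List ℕ) : Finset (ℕ × ℕ) :=
  (Finset.range μ.length ×ˢ Finset.range (μ.foldr max 0)).filter fun c =>
    c.2 < μ.getD c.1 0

namespace DyckPath

variable {n : ℕ}

/-- The natural unit interval order `P(d)`: `i ≺ j ↔ i < n ∧ j > d i`. -/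
def prec (D : DyckPath n) (i j : ℕ) : Prop := i < n ∧ D.d i < j

/-- Incomparability in `P(d)`. -/
def Incomp (D : DyckPath n) (x y : ℕ) : Prop := ¬ D.prec x y ∧ ¬ D.prec y x

/-- The bounce sequence `m 0 = d 1`, `m (k+1) = d (m k + 1)`. -/
def bounce (D : DyckPath n) : ℕ → ℕ
  | 0 => D.d 1
  | k + 1 => D.d (D.bounce k + 1)

def m0 (D : DyckPath n) : ℕ := D.bounce 0

def m1 (D : DyckPath n) : ℕ := D.bounce 1

/-- `d` has bounce number three: `m 2 = n` is the first bounce term equal to `n`. -/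
def BounceThree (D : DyckPath n) : Prop := D.m0 < n ∧ D.m1 < n ∧ D.bounce 2 = n

/-- `L` is the row-by-row reading word of a `P`-tableau of shape `μ`:
`L` uses each of `1, …, n` exactly once, rows strictly increase in `≺`, and for
vertically adjacent cells the lower entry is not `≺` the upper one. -/
def IsPTab (D : DyckPath n) (μ L : List ℕ) : Prop :=
  L.Perm (List.map (· + 1) (List.range n)) ∧ μ.sum = n ∧
  (∀ i j : ℕ, i < μ.length → j + 1 < μ.getD i 0 →
    D.prec (entry μ L i j) (entry μ L i (j + 1))) ∧
  (∀ i j : ℕ, i + 1 < μ.length → j < μ.getD (i + 1) 0 →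
    ¬ D.prec (entry μ L (i + 1) j) (entry μ L i j))

/-- The number of inversions of a `P`-tableau: pairs of entries `x > y`,
incomparable in `P`, with `x` in a strictly higher row than `y`. -/
noncomputable def invNum (D : DyckPath n) (μ L : List ℕ) : ℕ :=
  ((cellsOf μ ×ˢ cellsOf μ).filter fun pq =>
    pq.1.1 < pq.2.1 ∧ entry μ L pq.2.1 pq.2.2 < entry μ L pq.1.1 pq.1.2 ∧
      D.Incomp (entry μ L pq.1.1 pq.1.2) (entry μ L pq.2.1 pq.2.2)).card

/-- The finite set of (reading words of) `P`-tableaux of shape `μ`. -/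
noncomputable def ptabs (D : DyckPath n) (μ : List ℕ) : Finset (List ℕ) :=
  ((List.map (· + 1) (List.range n)).permutations.toFinset).filter fun L => D.IsPTab μ L

/-- `B_μ(q) = Σ_T q^{inv T}` over all `P`-tableaux `T` of shape `μ`, as a polynomial in `ℤ[q]`. -/
noncomputable def B (D : DyckPath n) (μ : List ℕ) : Polynomial ℤ :=
  ∑ L ∈ D.ptabs μ, Polynomial.X ^ D.invNum μ L

end DyckPath

/-- A strict order on `ℕ` of natural unit interval type, without chains of four elements. -/
structure IsShortUnitInterval (r : ℕ → ℕ → Prop) : Prop where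
  lt : ∀ {x y}, r x y → x < y
  left : ∀ {x y z}, x ≤ y → r y z → r x z
  right : ∀ {x y z}, r x y → y ≤ z → r x z
  no_chain : ∀ {x y z w}, r x y → r y z → r z w → False

namespace PWord

variable {r : ℕ → ℕ → Prop}

/-- Insert `x` into a word directly before the first letter which is not below `x`. -/
noncomputable def ins (r : ℕ → ℕ → Prop) (x : ℕ) : List ℕ → List ℕ
  | [] => [x]
  | e :: w => if r e x then e :: ins r x w else x :: e :: w

/-- The letters of a word which satisfy `p` and lie above all the letters before them. -/
noncomputable def recAux (r : ℕ → ℕ → Prop) : (ℕ → Prop) → List ℕ → List ℕ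
  | _, [] => []
  | p, e :: w => if p e then e :: recAux r (fun y => p y ∧ r e y) w
      else recAux r (fun y => p y ∧ r e y) w

/-- The left-to-right maxima of a word, without its first letter. -/
noncomputable def records (r : ℕ → ℕ → Prop) : List ℕ → List ℕ
  | [] => []
  | d :: w => recAux r (r d) w

/-- Insert `x` as the second letter. -/
def put (x : ℕ) : List ℕ → List ℕ
  | [] => [x]
  | d :: w => d :: x :: w

/-- Words none of whose descents is a descent of the order. -/
abbrev NoDesc (r : ℕ → ℕ → Prop) : List ℕ → Prop := List.IsChain fun x y => ¬ r y x

/-- The contribution of `x` before `y` to the number of inversions. -/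
noncomputable def invPair (r : ℕ → ℕ → Prop) (x y : ℕ) : ℕ := if y < x ∧ ¬ r y x then 1 else 0

/-- The number of inversions of a word. -/
noncomputable def inv (r : ℕ → ℕ → Prop) : List ℕ → ℕ
  | [] => 0
  | x :: w => (w.map (invPair r x)).sum + inv r w

/-- Rearrangement of words preserving the number of inversions. -/
def Eqv (r : ℕ → ℕ → Prop) (u v : List ℕ) : Prop := u.Perm v ∧ inv r u = inv r v

/-- Reading words of tableaux of shape `2 2 1 ⋯ 1`. -/
def Tab22 (r : ℕ → ℕ → Prop) (c : List ℕ) : Prop :=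
  ∃ a b d m t, c = a :: b :: d :: m :: t ∧ r a b ∧ r d m ∧ ¬ r d a ∧ ¬ r m b ∧ NoDesc r (d :: t)

/-- Reading words of tableaux of shape `3 1 ⋯ 1`. -/
def Tab31 (r : ℕ → ℕ → Prop) (c : List ℕ) : Prop :=
  ∃ a b z w, c = a :: b :: z :: w ∧ r a b ∧ r b z ∧ NoDesc r w

/-- Reading words of tableaux of shape `2 1 ⋯ 1`. -/
def Tab21 (r : ℕ → ℕ → Prop) (c : List ℕ) : Prop :=
  ∃ a b w, c = a :: b :: w ∧ r a b ∧ NoDesc r (a :: w)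

/-- Reading words of tableaux of shape `3 2 1 ⋯ 1`. -/
def Tab321 (r : ℕ → ℕ → Prop) (c : List ℕ) : Prop :=
  ∃ a b z d m t, c = a :: b :: z :: d :: m :: t ∧ r a b ∧ r b z ∧ r d m ∧ NoDesc r (d :: t)

/-- The left inverse of the injection, on words of shape `2 1 ⋯ 1`. -/
noncomputable def decode21 (r : ℕ → ℕ → Prop) : List ℕ → List ℕ ⊕ List ℕ
  | a :: b :: w =>
    match (records r w).find? (fun m => ¬ r m b) with
    | some m => Sum.inl (a :: b :: put m (w.erase m))
    | none =>
      let f := (records r w ++ w).headD 0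
      if r b f then Sum.inr (a :: b :: w)
      else match (records r (w.erase f)).getLast? with
        | none => Sum.inr (a :: f :: b :: w.erase f)
        | some m => if r m b then Sum.inl (a :: f :: put b (w.erase f))
            else Sum.inl (a :: m :: put b (ins r f ((w.erase f).erase m)))
  | _ => Sum.inl []

/-- The left inverse of the injection, on words of shape `3 2 1 ⋯ 1`. -/
noncomputable def decode321 (r : ℕ → ℕ → Prop) : List ℕ → List ℕ ⊕ List ℕ
  | a :: b :: z :: d :: m :: t =>
    let w := ins r m (d :: t)
    match (records r w).find? (fun x => r x m) with
    | none => Sum.inr (a :: b :: z :: w)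
    | some x =>
      if r x z then Sum.inl (a :: b :: put z w)
      else if r d b then Sum.inl (a :: x :: put z (ins r b (w.erase x)))
      else Sum.inl (d :: x :: put z (ins r b (a :: (w.erase x).tail)))
  | _ => Sum.inl []

theorem noDesc_cons_cons {x y : ℕ} {w : List ℕ} :
    NoDesc r (x :: y :: w) ↔ ¬ r y x ∧ NoDesc r (y :: w) := List.isChain_cons_cons

theorem Eqv.refl (u : List ℕ) : Eqv r u u := ⟨List.Perm.refl _, rfl⟩

theorem Eqv.symm {u v : List ℕ} (h : Eqv r u v) : Eqv r v u := ⟨h.1.symm, h.2.symm⟩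

theorem Eqv.trans {u v w : List ℕ} (h : Eqv r u v) (h' : Eqv r v w) : Eqv r u w :=
  ⟨h.1.trans h'.1, h.2.trans h'.2⟩

theorem Eqv.cons (x : ℕ) {u v : List ℕ} (h : Eqv r u v) : Eqv r (x :: u) (x :: v) :=
  ⟨h.1.cons x, by simp only [inv, h.2, (h.1.map _).sum_eq]⟩

theorem Eqv.append_left (p : List ℕ) {u v : List ℕ} (h : Eqv r u v) : Eqv r (p ++ u) (p ++ v) := by
  induction p with
  | nil => exact h
  | cons x p ih => exact ih.cons x

theorem recAux_and (m : ℕ) (p : ℕ → Prop) (w : List ℕ) :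
    recAux r (fun y => p y ∧ r m y) w = (recAux r p w).filter (fun y => r m y) := by
  induction w generalizing p with
  | nil => simp [recAux]
  | cons e w ih =>
    have hp : (fun y => (p y ∧ r m y) ∧ r e y) = fun y => (p y ∧ r e y) ∧ r m y := by
      funext y; exact propext (by tauto)
    simp only [recAux, hp, ih]
    by_cases h1 : p e <;> by_cases h2 : r m e <;> simp [h1, h2]

theorem of_mem_recAux {p : ℕ → Prop} {w : List ℕ} {y : ℕ} (hy : y ∈ recAux r p w) : p y := by
  induction w generalizing p with
  | nil => simp [recAux] at hy
  | cons e w ih =>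
    simp only [recAux] at hy
    split_ifs at hy with he
    · rcases List.mem_cons.1 hy with rfl | hy
      · exact he
      · exact (ih hy).1
    · exact (ih hy).1

theorem pairwise_recAux (p : ℕ → Prop) (w : List ℕ) : (recAux r p w).Pairwise r := by
  induction w generalizing p with
  | nil => simp [recAux]
  | cons e w ih =>
    simp only [recAux]
    split_ifs with he
    · exact List.pairwise_cons.2 ⟨fun y hy => (of_mem_recAux hy).2, ih _⟩
    · exact ih _

end PWord

namespace IsShortUnitInterval

open PWord

variable {r : ℕ → ℕ → Prop}

theorem irrefl (h : IsShortUnitInterval r) (x : ℕ) : ¬ r x x := fun hx => (h.lt hx).ne rfl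

theorem asymm (h : IsShortUnitInterval r) {x y : ℕ} (hx : r x y) : ¬ r y x :=
  fun hy => (h.lt hx).asymm (h.lt hy)

theorem trans (h : IsShortUnitInterval r) {x y z : ℕ} (hx : r x y) (hy : r y z) : r x z :=
  h.left (h.lt hx).le hy

theorem lt_of_left (h : IsShortUnitInterval r) {x y z : ℕ} (hx : r x z) (hy : ¬ r y z) : x < y :=
  lt_of_not_ge fun hle => hy (h.left hle hx)

theorem lt_of_right (h : IsShortUnitInterval r) {x y z : ℕ} (hx : r x z) (hy : ¬ r x y) : y < z :=
  lt_of_not_ge fun hle => hy (h.right hx hle)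

theorem erase_ins (h : IsShortUnitInterval r) (m : ℕ) (w : List ℕ) : (ins r m w).erase m = w := by
  induction w with
  | nil => simp [ins]
  | cons e w ih =>
    simp only [ins]
    split_ifs with he
    · have : e ≠ m := (h.lt he).ne
      rw [List.erase_cons_tail (by simpa using this), ih]
    · simp

theorem eqv_swap (h : IsShortUnitInterval r) {x y : ℕ} (hxy : r x y) (w : List ℕ) :
    Eqv r (x :: y :: w) (y :: x :: w) := by
  refine ⟨List.Perm.swap _ _ _, ?_⟩
  have h1 : invPair r x y = 0 := by
    have := h.lt hxy
    simp [invPair]; omega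
  have h2 : invPair r y x = 0 := by simp [invPair, hxy]
  simp only [inv, List.map_cons, List.sum_cons, h1, h2]
  omega

theorem eqv_ins (h : IsShortUnitInterval r) (m : ℕ) (w : List ℕ) :
    Eqv r (m :: w) (ins r m w) := by
  induction w with
  | nil => exact Eqv.refl _
  | cons e w ih =>
    simp only [ins]
    split_ifs with he
    · exact (h.eqv_swap he w).symm.trans (ih.cons e)
    · exact Eqv.refl _

theorem eqv_rotate (h : IsShortUnitInterval r) {b x z : ℕ} (hxz : r x z) (hbz : ¬ r b z)
    (hxb : ¬ r x b) (w : List ℕ) : Eqv r (b :: z :: x :: w) (x :: z :: b :: w) := by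
  have h1 := h.lt_of_left hxz hbz
  have h2 := h.lt_of_right hxz hxb
  have h3 := h.lt hxz
  refine Eqv.trans ⟨?_, ?_⟩ (h.eqv_swap hxz (b :: w)).symm
  · exact (List.Perm.swap _ _ _).trans ((List.Perm.swap _ _ _).cons z)
  · have e1 : invPair r b z = 0 := by simp [invPair]; omega
    have e2 : invPair r b x = 1 := by simp [invPair, h1, hxb]
    have e3 : invPair r z b = 1 := by simp [invPair, h2, hbz]
    have e4 : invPair r x b = 0 := by simp [invPair]; omega
    simp only [inv, List.map_cons, List.sum_cons, e1, e2, e3, e4]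
    omega

theorem eqv_exchange (h : IsShortUnitInterval r) {a b x z d : ℕ} (hab : r a b) (hdx : r d x)
    (hxz : r x z) (hda : ¬ r d a) (hax : ¬ r a x) (hbz : ¬ r b z) (hxb : ¬ r x b) (w : List ℕ) :
    Eqv r (a :: b :: z :: x :: d :: w) (d :: x :: z :: a :: b :: w) := by
  have l1 := h.lt_of_left hdx hax
  have l2 := h.lt_of_left hxz hbz
  have l3 := h.lt_of_right hxz hxb
  have l4 := h.lt_of_left hab hxb
  have hdb := h.right hdx l2.le
  have haz := h.right hab l3.le
  have hdz := h.trans hdx hxz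
  have low : ∀ {u v}, u < v → invPair r u v = 0 := fun huv => by simp [invPair]; omega
  have cmp : ∀ {u v}, r u v → invPair r v u = 0 := fun huv => by simp [invPair, huv]
  have one : ∀ {u v}, u < v → ¬ r u v → invPair r v u = 1 := fun huv hr => by
    simp [invPair, huv, hr]
  refine ⟨?_, ?_⟩
  · rw [List.perm_iff_count]
    intro y
    simp only [List.count_cons]
    omega
  · simp only [inv, List.map_cons, List.sum_cons, low (h.lt hab), low (h.lt haz), low l4,
      one l1 hda, low l3, one l2 hxb, cmp hdb, cmp hxz, cmp hdz, cmp hdx, low (h.lt hdx),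
      low (h.lt hdz), low l1, low (h.lt hdb), low (h.lt hxz), one l4 hax, low l2, cmp haz,
      one l3 hbz]
    omega

theorem noDesc_ins (h : IsShortUnitInterval r) {d x : ℕ} {w : List ℕ} (hd : ¬ r x d)
    (hw : NoDesc r (d :: w)) : NoDesc r (d :: ins r x w) := by
  induction w generalizing d with
  | nil => simpa [ins] using hd
  | cons e w ih =>
    rw [noDesc_cons_cons] at hw
    simp only [ins]
    split_ifs with he
    · exact noDesc_cons_cons.2 ⟨hw.1, ih (h.asymm he) hw.2⟩
    · exact noDesc_cons_cons.2 ⟨hd, noDesc_cons_cons.2 ⟨he, hw.2⟩⟩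

theorem exists_eq_ins (h : IsShortUnitInterval r) {d x : ℕ} {p : ℕ → Prop} {w : List ℕ}
    (hp : ∀ y, p y → r d y) (hw : NoDesc r (d :: w)) (hx : x ∈ recAux r p w) :
    ∃ v, w = ins r x v ∧ NoDesc r (d :: v) := by
  induction w generalizing d p with
  | nil => simp [recAux] at hx
  | cons e w ih =>
    rw [noDesc_cons_cons] at hw
    by_cases hxe : x = e
    · subst hxe
      have hpx : r d x := hp _ (of_mem_recAux hx)
      refine ⟨w, ?_, ?_⟩
      · cases w with
        | nil => rfl
        | cons f w => simp [ins, (noDesc_cons_cons.1 hw.2).1]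
      · cases w with
        | nil => simp
        | cons f w =>
          have hf := noDesc_cons_cons.1 hw.2
          exact noDesc_cons_cons.2 ⟨fun hfd => hf.1 (h.trans hfd hpx), hf.2⟩
    · have hx' : x ∈ recAux r (fun y => p y ∧ r e y) w := by
        simp only [recAux] at hx
        split_ifs at hx
        · exact (List.mem_cons.1 hx).resolve_left hxe
        · exact hx
      obtain ⟨v, rfl, hv⟩ := ih (fun y hy => hy.2) hw.2 hx'
      exact ⟨e :: v, by simp [ins, (of_mem_recAux hx').2],
        noDesc_cons_cons.2 ⟨hw.1, hv⟩⟩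

theorem recAux_ins (h : IsShortUnitInterval r) {m : ℕ} {p : ℕ → Prop} (hm : p m) (w : List ℕ) :
    recAux r p (ins r m w) = (recAux r p w).filter (fun y => r y m) ++
      m :: (recAux r p w).filter (fun y => r m y) := by
  induction w generalizing p with
  | nil => simp [ins, recAux, hm]
  | cons e w ih =>
    simp only [ins]
    split_ifs with he
    · have := ih (p := fun y => p y ∧ r e y) ⟨hm, he⟩
      simp only [recAux, this]
      by_cases hpe : p e <;> simp [hpe, he, h.asymm he]
    · have hnil : (recAux r p (e :: w)).filter (fun y => r y m) = [] := by
        rw [List.filter_eq_nil_iff]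
        intro y hy hym
        have hym : r y m := by simpa using hym
        simp only [recAux] at hy
        split_ifs at hy
        · rcases List.mem_cons.1 hy with rfl | hy
          · exact he hym
          · exact he (h.trans (of_mem_recAux hy).2 hym)
        · exact he (h.trans (of_mem_recAux hy).2 hym)
      rw [hnil, recAux, if_pos hm, recAux_and, List.nil_append]

theorem records_cons (d : ℕ) (t : List ℕ) : records r (d :: t) = recAux r (r d) t := rfl

theorem ins_cons_of {d x : ℕ} (hdx : r d x) (t : List ℕ) : ins r x (d :: t) = d :: ins r x t := by
  simp [ins, hdx]

theorem ins_cons_of_not {d x : ℕ} (hdx : ¬ r d x) (t : List ℕ) :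
    ins r x (d :: t) = x :: d :: t := by
  simp [ins, hdx]

theorem filter_below_eq_nil (h : IsShortUnitInterval r) {d x y : ℕ} (hxy : r x y) (t : List ℕ) :
    (recAux r (r d) t).filter (fun s => r s x) = [] := by
  rw [List.filter_eq_nil_iff]
  intro s hs hsx
  exact h.no_chain (of_mem_recAux hs) (by simpa using hsx) hxy

theorem records_ins (h : IsShortUnitInterval r) {b d : ℕ} {t : List ℕ} (hbd : ¬ r b d)
    (h1 : ∀ s ∈ recAux r (r d) t, ¬ r s b) (h2 : ∀ s ∈ recAux r (r d) t, ¬ r b s) :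
    (records r (ins r b (d :: t)) = [b] ∨ records r (ins r b (d :: t)) = []) ∧
      (records r (ins r b (d :: t)) ++ ins r b (d :: t)).headD 0 = b := by
  by_cases hdb : r d b
  · have e : records r (ins r b (d :: t)) = [b] := by
      rw [ins_cons_of hdb, records_cons, h.recAux_ins hdb, List.filter_eq_nil_iff.2,
        List.filter_eq_nil_iff.2]
      · rfl
      · simpa using h2
      · simpa using h1
    rw [e]
    simp
  · have e : records r (ins r b (d :: t)) = [] := by
      rw [ins_cons_of_not hdb, records_cons, recAux, if_neg hbd]
      have : (fun y => r b y ∧ r d y) = fun y => r d y ∧ r b y := by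
        funext y; exact propext and_comm
      rw [this, recAux_and, List.filter_eq_nil_iff.2]
      simpa using h2
    rw [e, ins_cons_of_not hdb]
    simp

theorem exists_decode_of_tab31 (h : IsShortUnitInterval r) {c : List ℕ} (hc : Tab31 r c) :
    (∃ c', Tab21 r c' ∧ Eqv r c c' ∧ decode21 r c' = Sum.inr c) ∨
      ∃ c', Tab321 r c' ∧ Eqv r c c' ∧ decode321 r c' = Sum.inr c := by
  obtain ⟨a, b, z, w, rfl, hab, hbz, hw⟩ := hc
  have haz := h.trans hab hbz
  have hzb := h.asymm hbz
  rcases w with _ | ⟨d, t⟩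
  · refine Or.inl ⟨[a, z, b], ⟨a, z, [b], rfl, haz, by simp [h.asymm hab]⟩,
      (h.eqv_swap hbz []).cons a, ?_⟩
    simp [decode21, records, recAux, hzb]
  · have hda : ¬ r d a := fun hd => h.no_chain hd hab hbz
    rcases hR : recAux r (r d) t with _ | ⟨x, R⟩
    · left
      by_cases hbd : r b d
      · have hzd : ¬ r z d := fun hd => h.no_chain hab hbz hd
        refine ⟨_, ⟨a, b, z :: d :: t, rfl, hab, ?_⟩, Eqv.refl _, ?_⟩
        · exact noDesc_cons_cons.2 ⟨h.asymm haz, noDesc_cons_cons.2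
            ⟨fun hd => h.no_chain hab hbd hd, hw⟩⟩
        · have e : records r (z :: d :: t) = [] := by
            rw [records_cons, recAux, if_neg hzd]
            have : (fun y => r z y ∧ r d y) = fun y => r d y ∧ r z y := by
              funext y; exact propext and_comm
            rw [this, recAux_and, hR, List.filter_nil]
          simp [decode21, e, hbz]
      · obtain ⟨e1, e2⟩ := h.records_ins hbd (t := t) (by simp [hR]) (by simp [hR])
        refine ⟨a :: z :: ins r b (d :: t), ⟨a, z, _, rfl, haz, ?_⟩,
          ((h.eqv_swap hbz _).trans ((h.eqv_ins b _).cons z)).cons a, ?_⟩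
        · exact h.noDesc_ins (h.asymm hab) (noDesc_cons_cons.2 ⟨hda, hw⟩)
        · have e3 : (records r (ins r b (d :: t))).find? (fun m => ¬ r m z) = none := by
            rcases e1 with e1 | e1 <;> simp [e1, hbz]
          simp only [decode21, e3, e2, h.erase_ins, if_neg hzb, records_cons, hR,
            List.getLast?_nil]
    · right
      obtain ⟨v, rfl, hv⟩ := h.exists_eq_ins (fun _ hy => hy) hw (x := x) (by rw [hR]; simp)
      have hdx : r d x := of_mem_recAux (p := r d) (w := ins r x v) (by rw [hR]; simp)
      refine ⟨a :: b :: z :: d :: x :: v, ⟨a, b, z, d, x, v, rfl, hab, hbz, hdx, hv⟩,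
        ((((h.eqv_ins x v).symm.cons d).cons z).cons b).cons a, ?_⟩
      have e : (records r (ins r x (d :: v))).find? (fun y => r y x) = none := by
        have hp := pairwise_recAux (r := r) (r d) (ins r x v)
        rw [hR, List.pairwise_cons] at hp
        rw [ins_cons_of hdx, records_cons, hR]
        simpa [h.irrefl x] using fun y hy => h.asymm (hp.1 y hy)
      simp only [decode321, e]
      rw [ins_cons_of hdx]

theorem exists_decode_of_tab22 (h : IsShortUnitInterval r) {c : List ℕ} (hc : Tab22 r c) :
    (∃ c', Tab21 r c' ∧ Eqv r c c' ∧ decode21 r c' = Sum.inl c) ∨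
      ∃ c', Tab321 r c' ∧ Eqv r c c' ∧ decode321 r c' = Sum.inl c := by
  obtain ⟨a, b, d, m, t, rfl, hab, hdm, hda, hmb, hw⟩ := hc
  rcases hF : ((recAux r (r d) t).filter (fun y => r y m)).find? (fun y => ¬ r y b) with _ | x
  · left
    refine ⟨a :: b :: ins r m (d :: t), ⟨a, b, _, rfl, hab, ?_⟩, ?_, ?_⟩
    · rw [ins_cons_of hdm]
      exact noDesc_cons_cons.2 ⟨hda, h.noDesc_ins (h.asymm hdm) hw⟩
    · rw [ins_cons_of hdm]
      exact (((h.eqv_ins m t).cons d).cons b).cons a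
    · have e : (records r (ins r m (d :: t))).find? (fun y => ¬ r y b) = some m := by
        rw [ins_cons_of hdm, records_cons, h.recAux_ins hdm, List.find?_append, hF]
        simp [hmb]
      simp only [decode21, e, h.erase_ins, put]
  · have hx := List.mem_of_find?_eq_some hF
    have hxb : ¬ r x b := by simpa using List.find?_some hF
    rw [List.mem_filter] at hx
    have hxm : r x m := by simpa using hx.2
    obtain ⟨v, rfl, hv⟩ := h.exists_eq_ins (fun _ hy => hy) hw hx.1
    have hdx : r d x := of_mem_recAux hx.1
    have hR := h.recAux_ins hdx v
    rw [h.filter_below_eq_nil hxm, List.nil_append] at hR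
    clear hF hx
    have hstart : Eqv r (a :: b :: d :: m :: ins r x v) (a :: b :: m :: d :: ins r x v) :=
      (((h.eqv_swap hdm _).cons b).cons a)
    by_cases hbm : r b m
    · have ham := h.trans hab hbm
      rcases hY : (recAux r (r d) v).filter (fun y => r x y) with _ | ⟨y, Y⟩
      · left
        rw [hY] at hR
        have hbd : ¬ r b d := fun hbd => h.no_chain hbd hdx hxm
        obtain ⟨e1, e2⟩ := h.records_ins hbd (t := ins r x v) (by simpa [hR] using hxb)
          (by simpa [hR] using fun hbx => h.no_chain hab hbx hxm)
        refine ⟨a :: m :: ins r b (d :: ins r x v), ⟨a, m, _, rfl, ham, ?_⟩,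
          hstart.trans (((h.eqv_swap hbm _).trans ((h.eqv_ins b _).cons m)).cons a), ?_⟩
        · exact h.noDesc_ins (h.asymm hab) (noDesc_cons_cons.2 ⟨hda, hw⟩)
        · have e3 : (records r (ins r b (d :: ins r x v))).find? (fun s => ¬ r s m) = none := by
            rcases e1 with e1 | e1 <;> simp [e1, hbm]
          simp only [decode21, e3, e2, h.erase_ins, if_neg (h.asymm hbm), records_cons, hR,
            List.getLast?_singleton, if_pos hxm, put]
      · right
        have hy : y ∈ (recAux r (r d) v).filter (fun y => r x y) := by rw [hY]; simp
        have hxy : r x y := by simpa using (List.mem_filter.1 hy).2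
        have hdy := h.trans hdx hxy
        obtain ⟨u, hu, hu'⟩ := h.exists_eq_ins (fun _ hy => hy) hw (x := y)
          (by rw [hR]; exact List.mem_cons_of_mem _ hy)
        refine ⟨a :: b :: m :: d :: y :: u, ⟨a, b, m, d, y, u, rfl, hab, hbm, hdy, hu'⟩,
          hstart.trans ?_, ?_⟩
        · rw [hu]
          exact ((((h.eqv_ins y u).symm.cons d).cons m).cons b).cons a
        · have e : (records r (d :: ins r x v)).find? (fun s => r s y) = some x := by
            rw [records_cons, hR]
            simp [hxy]
          simp only [decode321, ins_cons_of hdy, ← hu, e, if_pos hxm, put]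
    · have hxb' := h.lt_of_left hxm hbm
      have hbm' := h.lt_of_right hxm hxb
      have ham := h.right hab hbm'.le
      have hdb := h.right hdx hxb'.le
      have hbx : ¬ r b x := fun hbx => hbm (h.trans hbx hxm)
      have hRb := h.recAux_ins hdb v
      rcases hY : (recAux r (r d) v).filter (fun y => r b y) with _ | ⟨y, Y⟩
      · left
        rw [hY] at hRb
        have hwx : NoDesc r (d :: ins r b v) := h.noDesc_ins (h.asymm hdb) hv
        refine ⟨a :: m :: d :: ins r x (ins r b v), ⟨a, m, _, rfl, ham, ?_⟩, hstart.trans ?_, ?_⟩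
        · exact noDesc_cons_cons.2 ⟨hda, h.noDesc_ins (h.asymm hdx) hwx⟩
        · refine Eqv.cons a ?_
          rw [← ins_cons_of hdx, ← ins_cons_of hdx, ← ins_cons_of hdb]
          refine ((((h.eqv_ins x (d :: v)).symm.cons m).cons b).trans ?_)
          refine (h.eqv_rotate hxm hbm hxb _).trans ((h.eqv_swap hxm _).trans ?_)
          exact (((h.eqv_ins b (d :: v)).cons x).trans (h.eqv_ins x _)).cons m
        · have e : records r (d :: ins r x (ins r b v)) = [x] := by
            rw [records_cons, h.recAux_ins hdx, h.filter_below_eq_nil hxm, hRb,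
              List.filter_eq_nil_iff.2]
            · rfl
            · intro s hs hxs
              have hxs : r x s := by simpa using hxs
              rcases List.mem_append.1 hs with hs | hs
              · exact h.no_chain hdx hxs (by simpa using (List.mem_filter.1 hs).2)
              · exact hxb (by rwa [List.mem_singleton.1 hs] at hxs)
          have e1 : (d :: ins r x (ins r b v)).erase x = d :: ins r b v := by
            rw [← ins_cons_of hdx, h.erase_ins]
          have e2 : (d :: ins r b v).erase b = d :: v := by
            rw [← ins_cons_of hdb, h.erase_ins]
          have e3 : [x].find? (fun s => decide (¬ r s m)) = none := by simp [hxm]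
          simp only [decode21, e, e3, List.cons_append, List.headD_cons, if_neg (h.asymm hxm), e1,
            records_cons, hRb, List.getLast?_concat, if_neg hbm, e2, ins_cons_of hdx, put]
      · right
        have hy : y ∈ (recAux r (r d) v).filter (fun y => r b y) := by rw [hY]; simp
        have hby : r b y := by simpa using (List.mem_filter.1 hy).2
        have hdy := h.trans hdb hby
        have hay := h.trans hab hby
        obtain ⟨u, hu, hu'⟩ := h.exists_eq_ins (fun _ hy => hy) (h.noDesc_ins (h.asymm hdb) hv)
          (x := y) (by rw [hRb]; exact List.mem_append_right _ (List.mem_cons_of_mem _ hy))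
        by_cases hax : r a x
        · refine ⟨a :: x :: m :: d :: y :: u, ⟨a, x, m, d, y, u, rfl, hax, hxm, hdy, hu'⟩,
            hstart.trans (Eqv.cons a ?_), ?_⟩
          · rw [← ins_cons_of hdx]
            refine ((((h.eqv_ins x (d :: v)).symm.cons m).cons b).trans ?_)
            refine (h.eqv_rotate hxm hbm hxb _).trans (Eqv.cons x (Eqv.cons m ?_))
            refine (h.eqv_ins b (d :: v)).trans ?_
            rw [ins_cons_of hdb, hu]
            exact (h.eqv_ins y u).symm.cons d
          · have e : (records r (d :: ins r b v)).find? (fun s => r s y) = some b := by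
              rw [records_cons, hRb, h.filter_below_eq_nil hby]
              simp [hby]
            have e2 : (d :: ins r b v).erase b = d :: v := by
              rw [← ins_cons_of hdb, h.erase_ins]
            simp only [decode321, ins_cons_of hdy, ← hu, e, if_neg hbm, e2, if_pos hdx,
              ins_cons_of hdx, put]
        · have hau : NoDesc r (a :: u) := by
            rcases u with _ | ⟨e, u⟩
            · simp
            · exact noDesc_cons_cons.2 ⟨fun hea => h.no_chain hea hab hby,
                (noDesc_cons_cons.1 hu').2⟩
          refine ⟨d :: x :: m :: a :: y :: u, ⟨d, x, m, a, y, u, rfl, hdx, hxm, hay, hau⟩,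
            hstart.trans ?_, ?_⟩
          · rw [← ins_cons_of hdx]
            refine (((((h.eqv_ins x (d :: v)).symm.cons m).cons b).cons a).trans ?_)
            refine (h.eqv_exchange hab hdx hxm hda hax hbm hxb v).trans ?_
            refine (((Eqv.cons a ((h.eqv_ins b v).trans ?_)).cons m).cons x).cons d
            rw [hu]
            exact (h.eqv_ins y u).symm
          · have e : (records r (a :: ins r b v)).find? (fun s => r s y) = some b := by
              rw [records_cons, h.recAux_ins hab, h.filter_below_eq_nil hby]
              simp [hby]
            have e2 : (a :: ins r b v).erase b = a :: v := by
              rw [← ins_cons_of hab, h.erase_ins]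
            simp only [decode321, ins_cons_of hay, ← hu, e, if_neg hbm, e2, if_neg hax,
              List.tail_cons, ins_cons_of hdx, put]

end IsShortUnitInterval

section Tableau

variable {r : ℕ → ℕ → Prop}

theorem rowStart_le_rowStart (μ : List ℕ) {i j : ℕ} (hij : i ≤ j) :
    rowStart μ i ≤ rowStart μ j :=
  (List.take_sublist_take_left hij).sum_le_sum (fun _ _ => Nat.zero_le _)

theorem rowStart_succ (μ : List ℕ) (i : ℕ) :
    rowStart μ (i + 1) = rowStart μ i + μ.getD i 0 := by
  induction μ generalizing i with
  | nil => simp [rowStart]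
  | cons k μ ih =>
    cases i with
    | zero => simp [rowStart]
    | succ i =>
      have := ih i
      simp only [rowStart, List.take_succ_cons, List.sum_cons, List.getD_cons_succ] at this ⊢
      omega

theorem rowStart_le_sum (μ : List ℕ) (i : ℕ) : rowStart μ i ≤ μ.sum :=
  (List.take_sublist i μ).sum_le_sum (fun _ _ => Nat.zero_le _)

theorem rowStart_add_lt_rowStart {μ : List ℕ} {i i' j : ℕ} (hi : i < i') (hj : j < μ.getD i 0) :
    rowStart μ i + j < rowStart μ i' := by
  have := rowStart_le_rowStart μ (Nat.succ_le_of_lt hi)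
  rw [Nat.succ_eq_add_one, rowStart_succ] at this
  omega

theorem rowStart_add_lt_sum {μ : List ℕ} {i j : ℕ} (hj : j < μ.getD i 0) :
    rowStart μ i + j < μ.sum :=
  (rowStart_add_lt_rowStart i.lt_succ_self hj).trans_le (rowStart_le_sum μ _)

theorem exists_rowStart_add_eq {μ : List ℕ} {p : ℕ} (hp : p < μ.sum) :
    ∃ i j, i < μ.length ∧ j < μ.getD i 0 ∧ rowStart μ i + j = p := by
  induction μ generalizing p with
  | nil => simp at hp
  | cons k μ ih =>
    by_cases hk : p < k
    · exact ⟨0, p, by simp, by simpa using hk, by simp [rowStart]⟩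
    · rw [List.sum_cons] at hp
      obtain ⟨i, j, hi, hj, h⟩ := ih (p := p - k) (by omega)
      refine ⟨i + 1, j, by simpa using hi, by simpa using hj, ?_⟩
      simp only [rowStart, List.take_succ_cons, List.sum_cons] at h ⊢
      omega

theorem mem_cellsOf {μ : List ℕ} {c : ℕ × ℕ} :
    c ∈ cellsOf μ ↔ c.1 < μ.length ∧ c.2 < μ.getD c.1 0 := by
  have key : ∀ (μ : List ℕ) (i : ℕ), μ.getD i 0 ≤ μ.foldr max 0 := by
    intro μ
    induction μ with
    | nil => simp
    | cons k μ ih =>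
      rintro (_ | i)
      · simp
      · exact (ih i).trans (by simp)
  simp only [cellsOf, Finset.mem_filter, Finset.mem_product, Finset.mem_range]
  have := key μ c.1
  constructor
  · rintro ⟨⟨h1, _⟩, h2⟩
    exact ⟨h1, h2⟩
  · rintro ⟨h1, h2⟩
    exact ⟨⟨h1, by omega⟩, h2⟩

theorem entry_cons_zero (k : ℕ) (μ L : List ℕ) (j : ℕ) : entry (k :: μ) L 0 j = L.getD j 0 := by
  simp [entry, rowStart]

theorem entry_cons_succ (k : ℕ) (μ L : List ℕ) (i j : ℕ) :
    entry (k :: μ) L (i + 1) j = entry μ (L.drop k) i j := by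
  simp [entry, rowStart, List.getD_eq_getElem?_getD, List.getElem?_drop, add_assoc]

/-- The row and column conditions on the reading word of a tableau, for an arbitrary relation. -/
def TabConds (r : ℕ → ℕ → Prop) (μ L : List ℕ) : Prop :=
  (∀ i j : ℕ, i < μ.length → j + 1 < μ.getD i 0 →
    r (entry μ L i j) (entry μ L i (j + 1))) ∧
  (∀ i j : ℕ, i + 1 < μ.length → j < μ.getD (i + 1) 0 →
    ¬ r (entry μ L (i + 1) j) (entry μ L i j))

theorem tabConds_cons {k : ℕ} {μ L : List ℕ} :
    TabConds r (k :: μ) L ↔ (∀ j, j + 1 < k → r (L.getD j 0) (L.getD (j + 1) 0)) ∧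
      (∀ j, j < μ.getD 0 0 → ¬ r (L.getD (k + j) 0) (L.getD j 0)) ∧
      TabConds r μ (L.drop k) := by
  have e0 : ∀ M j, 0 < μ.length → entry μ M 0 j = M.getD j 0 := by
    intro M j _
    simp [entry, rowStart]
  have e1 : ∀ j, (L.drop k).getD j 0 = L.getD (k + j) 0 := by
    intro j
    simp [List.getD_eq_getElem?_getD, List.getElem?_drop]
  constructor
  · rintro ⟨h1, h2⟩
    refine ⟨fun j hj => ?_, fun j hj => ?_, fun i j hi hj => ?_, fun i j hi hj => ?_⟩
    · simpa only [entry_cons_zero] using h1 0 j (by simp) (by simpa using hj)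
    · have hμ : 0 < μ.length := by
        cases μ with
        | nil => simp at hj
        | cons => simp
      simpa only [entry_cons_zero, entry_cons_succ, e0 _ _ hμ, e1] using
        h2 0 j (by simpa using hμ) (by simpa using hj)
    · simpa only [entry_cons_succ] using h1 (i + 1) j (by simpa using hi) (by simpa using hj)
    · simpa only [entry_cons_succ] using h2 (i + 1) j (by simpa using hi) (by simpa using hj)
  · rintro ⟨h1, h2, h3, h4⟩
    refine ⟨fun i j hi hj => ?_, fun i j hi hj => ?_⟩
    · cases i with
      | zero => simpa only [entry_cons_zero] using h1 j (by simpa using hj)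
      | succ i =>
        simpa only [entry_cons_succ] using h3 i j (by simpa using hi) (by simpa using hj)
    · cases i with
      | zero =>
        have hμ : 0 < μ.length := by simpa using hi
        simpa only [entry_cons_zero, entry_cons_succ, e0 _ _ hμ, e1] using
          h2 j (by simpa using hj)
      | succ i =>
        simpa only [entry_cons_succ] using h4 i j (by simpa using hi) (by simpa using hj)

theorem tabConds_nil (L : List ℕ) : TabConds r [] L := by
  constructor <;> intro i j hi <;> simp at hi

theorem TabConds.row {μ L : List ℕ} (h : TabConds r μ L) {j : ℕ} (hj : j + 1 < μ.getD 0 0) :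
    r (L.getD j 0) (L.getD (j + 1) 0) := by
  cases μ with
  | nil => simp at hj
  | cons k μ => exact (tabConds_cons.1 h).1 j (by simpa using hj)

theorem TabConds.row_lt (hr : IsShortUnitInterval r) {μ L : List ℕ} (h : TabConds r μ L)
    {i j k : ℕ} (hi : i < μ.length) (hjk : j < k) (hk : k < μ.getD i 0) :
    r (entry μ L i j) (entry μ L i k) := by
  induction k, hjk using Nat.le_induction with
  | base => exact h.1 i j hi hk
  | succ k hjk ih => exact hr.trans (ih (by omega)) (h.1 i k hi hk)

theorem tabConds_three_cons (hr : IsShortUnitInterval r) {μ L : List ℕ} (hμ : μ.getD 0 0 ≤ 3) :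
    TabConds r (3 :: μ) L ↔ (r (L.getD 0 0) (L.getD 1 0) ∧ r (L.getD 1 0) (L.getD 2 0)) ∧
      TabConds r μ (L.drop 3) := by
  rw [tabConds_cons]
  constructor
  · rintro ⟨h1, -, h2⟩
    exact ⟨⟨h1 0 (by omega), h1 1 (by omega)⟩, h2⟩
  · rintro ⟨⟨h1, h2⟩, h3⟩
    have row : ∀ j, j + 1 < μ.getD 0 0 → r (L.getD (3 + j) 0) (L.getD (3 + (j + 1)) 0) := by
      intro j hj
      simpa [List.getD_eq_getElem?_getD, List.getElem?_drop] using h3.row hj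
    refine ⟨fun j hj => ?_, fun j hj hlt => ?_, h3⟩
    · obtain rfl | rfl : j = 0 ∨ j = 1 := by omega
      exacts [h1, h2]
    · obtain rfl | rfl | rfl : j = 0 ∨ j = 1 ∨ j = 2 := by omega
      · exact hr.no_chain hlt h1 h2
      · exact hr.no_chain (row 0 (by omega)) hlt h2
      · exact hr.no_chain (row 0 (by omega)) (row 1 (by omega)) hlt

theorem tabConds_replicate_three_append (hr : IsShortUnitInterval r) {l : ℕ} {ν L : List ℕ}
    (hν : ν.getD 0 0 ≤ 3) :
    TabConds r (List.replicate l 3 ++ ν) L ↔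
      (∀ i < l, r (L.getD (3 * i) 0) (L.getD (3 * i + 1) 0) ∧
        r (L.getD (3 * i + 1) 0) (L.getD (3 * i + 2) 0)) ∧ TabConds r ν (L.drop (3 * l)) := by
  induction l generalizing L with
  | zero => simp
  | succ l ih =>
    have hl : (List.replicate l 3 ++ ν).getD 0 0 ≤ 3 := by
      cases l with
      | zero => simpa using hν
      | succ l => simp [List.replicate_succ]
    have e : ∀ i j, (L.drop 3).getD (3 * i + j) 0 = L.getD (3 * (i + 1) + j) 0 := by
      intro i j
      rw [show 3 * (i + 1) + j = 3 + (3 * i + j) by ring]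
      simp [List.getD_eq_getElem?_getD, List.getElem?_drop]
    have e' : ∀ i, (L.drop 3).getD (3 * i) 0 = L.getD (3 * (i + 1)) 0 := fun i => e i 0
    rw [List.replicate_succ, List.cons_append, tabConds_three_cons hr hl, ih, ← and_assoc,
      List.drop_drop, Nat.forall_lt_succ_left, show 3 + 3 * l = 3 * (l + 1) by ring]
    simp only [e, e', mul_zero, zero_add]

theorem tabConds_replicate_one {m : ℕ} {w : List ℕ} (hw : w.length = m) :
    TabConds r (List.replicate m 1) w ↔ PWord.NoDesc r w := by
  induction w generalizing m with
  | nil => subst hw; simpa using tabConds_nil _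
  | cons x w ih =>
    subst hw
    rw [List.length_cons, List.replicate_succ, tabConds_cons, List.drop_one, List.tail_cons, ih rfl]
    cases w with
    | nil => simp
    | cons y w => simp [List.replicate_succ]

theorem tab22_of_tabConds {m : ℕ} {c : List ℕ} (hc : c.length = m + 4)
    (h : TabConds r (2 :: 2 :: List.replicate m 1) c) : PWord.Tab22 r c := by
  obtain ⟨a, b, d, x, t, rfl⟩ : ∃ a b d x t, c = a :: b :: d :: x :: t := by
    match c, hc with
    | a :: b :: d :: x :: t, _ => exact ⟨a, b, d, x, t, rfl⟩
  have ht : t.length = m := by simpa using hc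
  rw [tabConds_cons, tabConds_cons] at h
  obtain ⟨h1, h2, h3, h4, h5⟩ := h
  refine ⟨a, b, d, x, t, rfl, h1 0 (by omega), h3 0 (by omega), h2 0 (by simp), h2 1 (by simp), ?_⟩
  replace h5 := (tabConds_replicate_one ht).1 h5
  cases t with
  | nil => simp
  | cons e t =>
    subst ht
    exact PWord.noDesc_cons_cons.2 ⟨h4 0 (by simp [List.replicate_succ]), h5⟩

theorem tab31_of_tabConds (hr : IsShortUnitInterval r) {m : ℕ} {c : List ℕ} (hc : c.length = m + 3)
    (h : TabConds r (3 :: List.replicate m 1) c) : PWord.Tab31 r c := by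
  obtain ⟨a, b, z, w, rfl⟩ : ∃ a b z w, c = a :: b :: z :: w := by
    match c, hc with
    | a :: b :: z :: w, _ => exact ⟨a, b, z, w, rfl⟩
  have hm : (List.replicate m 1).getD 0 0 ≤ 3 := by cases m <;> simp [List.replicate_succ]
  rw [tabConds_three_cons hr hm] at h
  exact ⟨a, b, z, w, rfl, h.1.1, h.1.2, (tabConds_replicate_one (by simpa using hc)).1 h.2⟩

theorem tabConds_two_cons_replicate {m a b : ℕ} {w : List ℕ} (hw : w.length = m) :
    TabConds r (2 :: List.replicate m 1) (a :: b :: w) ↔ r a b ∧ PWord.NoDesc r (a :: w) := by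
  rw [tabConds_cons, show (a :: b :: w).drop 2 = w from rfl, tabConds_replicate_one hw]
  subst hw
  have h2 : (∀ j, j + 1 < 2 → r ((a :: b :: w).getD j 0) ((a :: b :: w).getD (j + 1) 0)) ↔
      r a b := ⟨fun h => h 0 (by omega), fun h j hj => by obtain rfl : j = 0 := by omega
                                                          exact h⟩
  rw [h2]
  cases w with
  | nil => simp
  | cons e w => simp [List.replicate_succ]

theorem tabConds_three_cons_two_cons_replicate (hr : IsShortUnitInterval r) {m a b z d x : ℕ}
    {t : List ℕ} (ht : t.length = m) :
    TabConds r (3 :: 2 :: List.replicate m 1) (a :: b :: z :: d :: x :: t) ↔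
      (r a b ∧ r b z) ∧ r d x ∧ PWord.NoDesc r (d :: t) := by
  rw [tabConds_three_cons hr (by simp), ← tabConds_two_cons_replicate ht]
  rfl

end Tableau

theorem PWord.inv_eq_card (r : ℕ → ℕ → Prop) (L : List ℕ) :
    PWord.inv r L = ((Finset.range L.length ×ˢ Finset.range L.length).filter fun pq =>
      pq.1 < pq.2 ∧ L.getD pq.2 0 < L.getD pq.1 0 ∧ ¬ r (L.getD pq.2 0) (L.getD pq.1 0)).card := by
  rw [Finset.card_filter, Finset.sum_product]
  induction L with
  | nil => simp [PWord.inv]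
  | cons x w ih =>
    have hsum : (w.map (PWord.invPair r x)).sum =
        ∑ q ∈ Finset.range w.length, PWord.invPair r x (w.getD q 0) := by
      rw [← Fin.sum_univ_eq_sum_range (fun q => PWord.invPair r x (w.getD q 0)),
        ← List.sum_ofFn]
      congr 1
      exact List.ext_getElem (by simp) (fun i _ _ => by simp)
    simp only [PWord.inv, ih, hsum, List.length_cons, Finset.sum_range_succ', PWord.invPair,
      List.getD_cons_succ, List.getD_cons_zero, Nat.not_lt_zero, false_and, if_false, add_zero,
      Nat.succ_lt_succ_iff, Nat.succ_pos, true_and]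
    rw [add_comm]

namespace DyckPath

variable {n : ℕ}

/-- The order of `P(d)`, extended to all natural numbers by clamping them to `1, …, n`. -/
def extPrec (D : DyckPath n) (x y : ℕ) : Prop := D.d (max 1 (min x n)) < max 1 (min y n)

theorem prec_iff_extPrec (D : DyckPath n) {x y : ℕ} (hx : x ∈ Set.Icc 1 n) (hy : y ∈ Set.Icc 1 n) :
    D.prec x y ↔ D.extPrec x y := by
  obtain ⟨hx1, hxn⟩ := hx
  obtain ⟨hy1, hyn⟩ := hy
  rw [prec, extPrec, min_eq_left hxn, min_eq_left hyn, max_eq_right hx1, max_eq_right hy1]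
  refine ⟨And.right, fun h => ⟨lt_of_le_of_ne hxn ?_, h⟩⟩
  rintro rfl
  rw [D.top] at h
  omega

theorem isShortUnitInterval_extPrec (D : DyckPath n) (h3 : D.BounceThree) :
    IsShortUnitInterval D.extPrec := by
  obtain ⟨h0, h1, h2⟩ := h3
  have hn : 1 ≤ n := by omega
  have key : ∀ {x y m}, m < n → m < max 1 (min x n) → D.extPrec x y →
      D.d (m + 1) < max 1 (min y n) := by
    intro x y m hm hx hxy
    exact (D.mono _ _ (by omega) hx (by omega)).trans_lt hxy
  refine ⟨fun {x y} h => ?_, fun {x y z} hxy h => ?_, fun {x y z} h hyz => ?_,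
    fun {x y z w} hxy hyz hzw => ?_⟩
  · have := D.ge_self (max 1 (min x n)) (by omega) (by omega)
    simp only [extPrec] at h
    omega
  · exact (D.mono (max 1 (min x n)) (max 1 (min y n)) (by omega) (by omega) (by omega)).trans_lt h
  · simp only [extPrec] at h ⊢
    omega
  · have k1 : D.m0 < max 1 (min y n) := key (m := 0) (by omega) (by omega) hxy
    have k2 : D.m1 < max 1 (min z n) := key h0 k1 hyz
    have k3 : D.bounce 2 < max 1 (min w n) := key h1 k2 hzw
    omega

theorem mem_Icc_of_perm {L : List ℕ} (hL : L.Perm (List.map (· + 1) (List.range n))) {p : ℕ}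
    (hp : p < n) : L.getD p 0 ∈ Set.Icc 1 n := by
  have hlen : L.length = n := by simpa using hL.length_eq
  have hmem : L.getD p 0 ∈ List.map (· + 1) (List.range n) := by
    rw [← hL.mem_iff, List.getD_eq_getElem _ _ (by omega)]
    exact List.getElem_mem _
  simp only [List.mem_map, List.mem_range] at hmem
  obtain ⟨y, hy, h⟩ := hmem
  rw [← h]
  exact ⟨by omega, by omega⟩

theorem isPTab_iff (D : DyckPath n) {μ L : List ℕ} :
    D.IsPTab μ L ↔ L.Perm (List.map (· + 1) (List.range n)) ∧ μ.sum = n ∧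
      TabConds D.extPrec μ L := by
  refine and_congr_right fun hL => and_congr_right fun hμ => ?_
  have hentry : ∀ {i j}, rowStart μ i + j < μ.sum → entry μ L i j ∈ Set.Icc 1 n :=
    fun h => mem_Icc_of_perm hL (h.trans_eq hμ)
  refine and_congr ?_ ?_
  · refine forall₄_congr fun i j _ hj => ?_
    exact D.prec_iff_extPrec (hentry (rowStart_add_lt_sum (by omega)))
      (hentry (rowStart_add_lt_sum hj))
  · refine forall₄_congr fun i j _ hj => not_congr ?_
    have h := rowStart_add_lt_sum hj
    have := rowStart_le_rowStart μ i.le_succ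
    exact D.prec_iff_extPrec (hentry h) (hentry (by rw [Nat.succ_eq_add_one] at this; omega))

theorem invNum_eq_inv (D : DyckPath n) (h3 : D.BounceThree) {μ L : List ℕ} (h : D.IsPTab μ L) :
    D.invNum μ L = PWord.inv D.extPrec L := by
  have hr := D.isShortUnitInterval_extPrec h3
  obtain ⟨hL, hμ, hT⟩ := D.isPTab_iff.1 h
  have hlen : L.length = μ.sum := by simpa [hμ] using hL.length_eq
  have hprec : ∀ {c c' : ℕ × ℕ}, c.2 < μ.getD c.1 0 → c'.2 < μ.getD c'.1 0 →
      (D.prec (entry μ L c.1 c.2) (entry μ L c'.1 c'.2) ↔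
        D.extPrec (entry μ L c.1 c.2) (entry μ L c'.1 c'.2)) := fun hc hc' =>
    D.prec_iff_extPrec (mem_Icc_of_perm hL ((rowStart_add_lt_sum hc).trans_eq hμ))
      (mem_Icc_of_perm hL ((rowStart_add_lt_sum hc').trans_eq hμ))
  rw [PWord.inv_eq_card, invNum, hlen]
  refine Finset.card_nbij
    (fun pq => (rowStart μ pq.1.1 + pq.1.2, rowStart μ pq.2.1 + pq.2.2)) ?_ ?_ ?_
  · intro pq hc
    obtain ⟨c, c'⟩ := pq
    simp only [Finset.coe_filter, Set.mem_ofPred_eq, Finset.mem_product, mem_cellsOf,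
      Finset.mem_range] at hc ⊢
    obtain ⟨⟨⟨_, hc1⟩, _, hc2⟩, hlt, hinv, _, hinc⟩ := hc
    exact ⟨⟨rowStart_add_lt_sum hc1, rowStart_add_lt_sum hc2⟩,
      (rowStart_add_lt_rowStart hlt hc1).trans_le (Nat.le_add_right _ _), hinv,
      fun hlt => hinc ((hprec hc2 hc1).2 hlt)⟩
  · have inj : ∀ {c c' : ℕ × ℕ}, c.2 < μ.getD c.1 0 → c'.2 < μ.getD c'.1 0 →
        rowStart μ c.1 + c.2 = rowStart μ c'.1 + c'.2 → c = c' := by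
      rintro ⟨i, j⟩ ⟨i', j'⟩ hc hc' heq
      obtain hlt | rfl | hlt := lt_trichotomy i i'
      · have := rowStart_add_lt_rowStart hlt hc
        simp only at heq this
        omega
      · simpa using heq
      · have := rowStart_add_lt_rowStart hlt hc'
        simp only at heq this
        omega
    rintro ⟨c, c'⟩ hc ⟨e, e'⟩ he heq
    simp only [Finset.coe_filter, Finset.mem_product, mem_cellsOf, Set.mem_ofPred_eq] at hc he
    simp only [Prod.mk.injEq] at heq
    rw [inj hc.1.1.2 he.1.1.2 heq.1, inj hc.1.2.2 he.1.2.2 heq.2]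
  · rintro ⟨p, q⟩ hpq
    simp only [Finset.coe_filter, Finset.mem_product, Finset.mem_range, Set.mem_ofPred_eq] at hpq
    obtain ⟨⟨hp, hq⟩, hlt, hinv, hinc⟩ := hpq
    obtain ⟨i, j, hi, hj, rfl⟩ := exists_rowStart_add_eq hp
    obtain ⟨i', j', hi', hj', rfl⟩ := exists_rowStart_add_eq hq
    refine ⟨((i, j), (i', j')), ?_, rfl⟩
    simp only [Finset.coe_filter, Finset.mem_product, mem_cellsOf, Set.mem_ofPred_eq]
    refine ⟨⟨⟨hi, hj⟩, hi', hj'⟩, ?_, hinv, fun hlt => ?_, fun hlt => ?_⟩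
    · obtain hlt' | rfl | hlt' := lt_trichotomy i i'
      · exact hlt'
      · have := hr.lt (hT.row_lt hr hi (show j < j' by omega) hj')
        exact absurd hinv this.not_gt
      · have := rowStart_add_lt_rowStart hlt' hj'
        omega
    · exact (hr.lt ((hprec (c := (i, j)) (c' := (i', j')) hj hj').1 hlt)).not_gt hinv
    · exact hinc ((hprec (c := (i', j')) (c' := (i, j)) hj' hj).1 hlt)

/-- Rearranging the rows of a tableau below its first `l` rows of length three. -/
theorem isPTab_take_append (D : DyckPath n) (h3 : D.BounceThree) {l : ℕ} {ν ν' L c : List ℕ}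
    (hL : D.IsPTab (List.replicate l 3 ++ ν) L) (hν : ν.getD 0 0 ≤ 3) (hν' : ν'.getD 0 0 ≤ 3)
    (he : PWord.Eqv D.extPrec (L.drop (3 * l)) c) (hs : ν'.sum = ν.sum)
    (hc : TabConds D.extPrec ν' c) :
    ∃ L', D.IsPTab (List.replicate l 3 ++ ν') L' ∧ L'.take (3 * l) = L.take (3 * l) ∧
      L'.drop (3 * l) = c ∧
      D.invNum (List.replicate l 3 ++ ν') L' = D.invNum (List.replicate l 3 ++ ν) L := by
  have hr := D.isShortUnitInterval_extPrec h3
  obtain ⟨hP, hsum, hT⟩ := D.isPTab_iff.1 hL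
  have hlen : L.length = n := by simpa using hP.length_eq
  have hle : (L.take (3 * l)).length = 3 * l := by
    simp only [List.sum_append, List.sum_replicate, smul_eq_mul] at hsum
    rw [List.length_take, hlen]
    omega
  have heqv : PWord.Eqv D.extPrec L (L.take (3 * l) ++ c) := by
    simpa using he.append_left (L.take (3 * l))
  have hget : ∀ i < 3 * l, (L.take (3 * l) ++ c).getD i 0 = L.getD i 0 := by
    intro i hi
    rw [List.getD_append _ _ _ _ (by omega)]
    simp [List.getD_eq_getElem?_getD, hi]
  have hdrop : (L.take (3 * l) ++ c).drop (3 * l) = c := by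
    rw [List.drop_append_of_le_length hle.ge, List.drop_eq_nil_of_le hle.le, List.nil_append]
  have hL' : D.IsPTab (List.replicate l 3 ++ ν') (L.take (3 * l) ++ c) := by
    refine D.isPTab_iff.2 ⟨heqv.1.symm.trans hP, ?_, ?_⟩
    · rw [← hsum, List.sum_append, List.sum_append, hs]
    · rw [tabConds_replicate_three_append hr hν] at hT
      rw [tabConds_replicate_three_append hr hν', hdrop]
      refine ⟨fun i hi => ?_, hc⟩
      rw [hget _ (by omega), hget _ (by omega), hget _ (by omega)]
      exact hT.1 i hi
  refine ⟨_, hL', ?_, hdrop, ?_⟩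
  · rw [List.take_append_of_le_length hle.ge, List.take_take, min_self]
  · rw [D.invNum_eq_inv h3 hL', D.invNum_eq_inv h3 hL, heqv.2]

/-- The rearrangements of a tableau of shape `3^l ν` into the shapes `3^l 2 1^{n-3l-2}` and
`3^{l+1} 2 1^{n-3l-5}`, recovered by `f` and `g` respectively. -/
theorem exists_isPTab_of_exists_tab (D : DyckPath n) (h3 : D.BounceThree) {l : ℕ} {ν L : List ℕ}
    {α : Type*} {f g : List ℕ → α} {s : α}
    (hL : D.IsPTab (List.replicate l 3 ++ ν) L) (hν : ν.getD 0 0 ≤ 3)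
    (hc : (∃ c, PWord.Tab21 D.extPrec c ∧ PWord.Eqv D.extPrec (L.drop (3 * l)) c ∧ f c = s) ∨
      ∃ c, PWord.Tab321 D.extPrec c ∧ PWord.Eqv D.extPrec (L.drop (3 * l)) c ∧ g c = s) :
    (∃ L', D.IsPTab (shape l 1 (n - 3 * l - 2)) L' ∧ L'.take (3 * l) = L.take (3 * l) ∧
        f (L'.drop (3 * l)) = s ∧
        D.invNum (shape l 1 (n - 3 * l - 2)) L' = D.invNum (List.replicate l 3 ++ ν) L) ∨
      ∃ L', D.IsPTab (shape (l + 1) 1 (n - 3 * l - 5)) L' ∧ L'.take (3 * l) = L.take (3 * l) ∧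
        g (L'.drop (3 * l)) = s ∧
        D.invNum (shape (l + 1) 1 (n - 3 * l - 5)) L' = D.invNum (List.replicate l 3 ++ ν) L := by
  have hr := D.isShortUnitInterval_extPrec h3
  have hlen : L.length = n := by simpa using hL.1.length_eq
  have hsum : 3 * l + ν.sum = n := by
    rw [← hL.2.1]
    simp [mul_comm]
  have hcl : ∀ {c}, PWord.Eqv D.extPrec (L.drop (3 * l)) c → c.length = ν.sum := fun he => by
    rw [← he.1.length_eq, List.length_drop]
    omega
  rcases hc with ⟨c, ⟨a, b, w, rfl, hab, hw⟩, he, hf⟩ |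
    ⟨c, ⟨a, b, z, d, m, t, rfl, hab, hbz, hdm, ht⟩, he, hg⟩
  · left
    have hl := hcl he
    simp only [List.length_cons] at hl
    obtain ⟨L', h1, h2, h4, h5⟩ := D.isPTab_take_append h3
      (ν' := 2 :: List.replicate (n - 3 * l - 2) 1) hL hν (by simp) he (by simp; omega)
      ((tabConds_two_cons_replicate (by omega)).2 ⟨hab, hw⟩)
    have hs : shape l 1 (n - 3 * l - 2) =
      List.replicate l 3 ++ 2 :: List.replicate (n - 3 * l - 2) 1 := by simp [shape]
    rw [hs]
    exact ⟨L', h1, h2, by rw [h4, hf], h5⟩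
  · right
    have hl := hcl he
    simp only [List.length_cons] at hl
    obtain ⟨L', h1, h2, h4, h5⟩ := D.isPTab_take_append h3
      (ν' := 3 :: 2 :: List.replicate (n - 3 * l - 5) 1) hL hν (by simp) he (by simp; omega)
      ((tabConds_three_cons_two_cons_replicate hr (by omega)).2 ⟨⟨hab, hbz⟩, hdm, ht⟩)
    have hs : shape (l + 1) 1 (n - 3 * l - 5) =
      List.replicate l 3 ++ 3 :: 2 :: List.replicate (n - 3 * l - 5) 1 := by
      simp [shape, List.replicate_succ']
    rw [hs]
    exact ⟨L', h1, h2, by rw [h4, hg], h5⟩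

end DyckPath

/-- An inversion-preserving injection from the disjoint union of the
`P`-tableaux of shapes `3^l 2^2 1^{n-3l-4}` and `3^{l+1} 1^{n-3l-3}` into the disjoint union
of the `P`-tableaux of shapes `3^l 2 1^{n-3l-2}` and `3^{l+1} 2 1^{n-3l-5}`. -/
theorem exists_injection_phi
    (n : ℕ) (D : DyckPath n) (h3 : D.BounceThree)
    (l : ℕ) (hl : l ≤ min (n - D.m1) (min (D.m1 - D.m0) D.m0)) :
    ∃ φ : {L : List ℕ // D.IsPTab (shape l 2 (n - 3 * l - 4)) L} ⊕
        {L : List ℕ // D.IsPTab (shape (l + 1) 0 (n - 3 * l - 3)) L} →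
        {L : List ℕ // D.IsPTab (shape l 1 (n - 3 * l - 2)) L} ⊕
        {L : List ℕ // D.IsPTab (shape (l + 1) 1 (n - 3 * l - 5)) L},
      Function.Injective φ ∧
      ∀ T, Sum.elim (fun S => D.invNum (shape l 1 (n - 3 * l - 2)) S.1)
          (fun S => D.invNum (shape (l + 1) 1 (n - 3 * l - 5)) S.1) (φ T)
        = Sum.elim (fun S => D.invNum (shape l 2 (n - 3 * l - 4)) S.1)
            (fun S => D.invNum (shape (l + 1) 0 (n - 3 * l - 3)) S.1) T := by
  have hr := D.isShortUnitInterval_extPrec h3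
  let src : {L : List ℕ // D.IsPTab (shape l 2 (n - 3 * l - 4)) L} ⊕
      {L : List ℕ // D.IsPTab (shape (l + 1) 0 (n - 3 * l - 3)) L} →
      List ℕ × (List ℕ ⊕ List ℕ) :=
    Sum.elim (fun S => (S.1.take (3 * l), Sum.inl (S.1.drop (3 * l))))
      (fun S => (S.1.take (3 * l), Sum.inr (S.1.drop (3 * l))))
  let dec : {L : List ℕ // D.IsPTab (shape l 1 (n - 3 * l - 2)) L} ⊕
      {L : List ℕ // D.IsPTab (shape (l + 1) 1 (n - 3 * l - 5)) L} →
      List ℕ × (List ℕ ⊕ List ℕ) :=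
    Sum.elim (fun S => (S.1.take (3 * l), PWord.decode21 D.extPrec (S.1.drop (3 * l))))
      (fun S => (S.1.take (3 * l), PWord.decode321 D.extPrec (S.1.drop (3 * l))))
  have hsrc : Function.Injective src := by
    have ext : ∀ {u v : List ℕ}, u.take (3 * l) = v.take (3 * l) →
        u.drop (3 * l) = v.drop (3 * l) → u = v := fun {u v} h1 h2 => by
      rw [← List.take_append_drop (3 * l) u, h1, h2, List.take_append_drop]
    rintro (⟨u, hu⟩ | ⟨u, hu⟩) (⟨v, hv⟩ | ⟨v, hv⟩) h <;>
      simp only [src, Sum.elim_inl, Sum.elim_inr, Prod.mk.injEq, Sum.inl.injEq, Sum.inr.injEq,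
        reduceCtorEq, and_false] at h
    · obtain rfl := ext h.1 h.2
      rfl
    · obtain rfl := ext h.1 h.2
      rfl
  have main : ∀ T, ∃ T', dec T' = src T ∧
      Sum.elim (fun S => D.invNum (shape l 1 (n - 3 * l - 2)) S.1)
          (fun S => D.invNum (shape (l + 1) 1 (n - 3 * l - 5)) S.1) T'
        = Sum.elim (fun S => D.invNum (shape l 2 (n - 3 * l - 4)) S.1)
            (fun S => D.invNum (shape (l + 1) 0 (n - 3 * l - 3)) S.1) T := by
    rintro (⟨L, hL⟩ | ⟨L, hL⟩)
    · have hs : shape l 2 (n - 3 * l - 4) =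
          List.replicate l 3 ++ 2 :: 2 :: List.replicate (n - 3 * l - 4) 1 := by
        simp [shape, List.replicate_succ]
      have hL' := hL
      rw [hs] at hL'
      obtain ⟨hP, hsum, hT⟩ := D.isPTab_iff.1 hL'
      have hlen : (L.drop (3 * l)).length = (n - 3 * l - 4) + 4 := by
        have hn : L.length = n := by simpa using hP.length_eq
        simp at hsum
        rw [List.length_drop]
        omega
      rw [tabConds_replicate_three_append hr (by simp)] at hT
      rcases D.exists_isPTab_of_exists_tab h3 hL' (by simp)
        (hr.exists_decode_of_tab22 (tab22_of_tabConds hlen hT.2)) with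
        ⟨L', h1, h2, h4, h5⟩ | ⟨L', h1, h2, h4, h5⟩
      · exact ⟨Sum.inl ⟨L', h1⟩, Prod.ext h2 h4, by simpa [hs] using h5⟩
      · exact ⟨Sum.inr ⟨L', h1⟩, Prod.ext h2 h4, by simpa [hs] using h5⟩
    · have hs : shape (l + 1) 0 (n - 3 * l - 3) =
          List.replicate l 3 ++ 3 :: List.replicate (n - 3 * l - 3) 1 := by
        simp [shape, List.replicate_succ']
      have hL' := hL
      rw [hs] at hL'
      obtain ⟨hP, hsum, hT⟩ := D.isPTab_iff.1 hL'
      have hlen : (L.drop (3 * l)).length = (n - 3 * l - 3) + 3 := by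
        have hn : L.length = n := by simpa using hP.length_eq
        simp at hsum
        rw [List.length_drop]
        omega
      rw [tabConds_replicate_three_append hr (by simp)] at hT
      rcases D.exists_isPTab_of_exists_tab h3 hL' (by simp)
        (hr.exists_decode_of_tab31 (tab31_of_tabConds hr hlen hT.2)) with
        ⟨L', h1, h2, h4, h5⟩ | ⟨L', h1, h2, h4, h5⟩
      · exact ⟨Sum.inl ⟨L', h1⟩, Prod.ext h2 h4, by simpa [hs] using h5⟩
      · exact ⟨Sum.inr ⟨L', h1⟩, Prod.ext h2 h4, by simpa [hs] using h5⟩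
  choose φ hφ hinv using main
  exact ⟨φ, fun T T' h => hsrc (by rw [← hφ, ← hφ, h]), hinv⟩
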